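/- Let n ≥ 2, let E₁, …, Eₙ be alphabets, let E_s = ∪_{i≠j}(Eᵢ ∩ Eⱼ), and let E_k satisfy E_s ⊆ E_k ⊆ E := E₁ ∪ … ∪ Eₙ. For i = 1, …, n let (Kᵢ, Nᵢ) model a generator over Eᵢ and let (K_k, N_k) model a generator over E_k. Define the marked language K = K₁ ∥ … ∥ Kₙ ∥ K_k and the generated language N = N₁ ∥ … ∥ Nₙ ∥ N_k of the coordinated system. Then the coordinated system is nonblocking, i.e., overline(K) = N, if and only if both: (1) for every i = 1, …, n, overline(Kᵢ ∥ K_k ∥ (∥_{j≠i} P_k(Kⱼ))) = Nᵢ ∥ N_k ∥ (∥_{j≠i} P_k(Nⱼ)); and (2) overline(K) is conditionally decomposable with respect to E₁, …, Eₙ and E_k. -/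

import Mathlib

/- Language-theoretic model of discrete-event systems:
   strings over a finite alphabet (a `Finset` of symbols) are lists,
   natural projections erase letters outside the target alphabet,
   and the parallel composition is the standard synchronous composition. -/

namespace DES

variable {A : Type} [DecidableEq A]

/-- `star E` is `E*`: the set of finite strings over the alphabet `E`. -/
def star (E : Finset A) : Set (List A) :=
  {w | ∀ a ∈ w, a ∈ E}

/-- The natural projection onto `E₀`: it keeps letters of `E₀` and erases all
other letters. -/
def proj (E₀ : Finset A) (w : List A) : List A :=
  w.filter (· ∈ E₀)

/-- The inverse image `P⁻¹(L) = { s ∈ E* : P(s) ∈ L }` of the natural projection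
from `E*` onto `E₀*`. -/
def invProj (E E₀ : Finset A) (L : Set (List A)) : Set (List A) :=
  {s | s ∈ star E ∧ proj E₀ s ∈ L}

/-- Parallel composition `L₁ ∥ L₂ = P₁⁻¹(L₁) ∩ P₂⁻¹(L₂) ⊆ (E₁ ∪ E₂)*` of
`L₁ ⊆ E₁*` and `L₂ ⊆ E₂*`. -/
def par (E₁ E₂ : Finset A) (L₁ L₂ : Set (List A)) : Set (List A) :=
  invProj (E₁ ∪ E₂) E₁ L₁ ∩ invProj (E₁ ∪ E₂) E₂ L₂

/-- Parallel composition of a finite family `L i ⊆ (E i)*`. -/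
def parFam {ι : Type} [Fintype ι] (E : ι → Finset A) (L : ι → Set (List A)) :
    Set (List A) :=
  {w | w ∈ star (Finset.univ.sup E) ∧ ∀ i, proj (E i) w ∈ L i}

/-- The prefix closure of a language. -/
def pref (L : Set (List A)) : Set (List A) :=
  {w | ∃ u, w ++ u ∈ L}

/-- `K` is conditionally decomposable w.r.t. the alphabets `E i` and `Ek`:
`K = P_{1+k}(K) ∥ ⋯ ∥ P_{n+k}(K)`. -/
def condDecomp {ι : Type} [Fintype ι] (E : ι → Finset A) (Ek : Finset A)
    (K : Set (List A)) : Prop :=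
  K = parFam (fun i => E i ∪ Ek) (fun i => proj (E i ∪ Ek) '' K)

/-- Conditional decomposability for two components:
`K = P_{1+k}(K) ∥ P_{2+k}(K)`. -/
def condDecomp2 (E₁ E₂ Ek : Finset A) (K : Set (List A)) : Prop :=
  K = par (E₁ ∪ Ek) (E₂ ∪ Ek) (proj (E₁ ∪ Ek) '' K) (proj (E₂ ∪ Ek) '' K)

/-- The natural projection from `E'*` onto `E₀*` is an `L`-observer. -/
def observer (E' E₀ : Finset A) (L : Set (List A)) : Prop :=
  ∀ t ∈ proj E₀ '' L, ∀ s ∈ pref L, proj E₀ s <+: t →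
    ∃ u ∈ star E', s ++ u ∈ L ∧ proj E₀ (s ++ u) = t

/-- Letter-to-letter renaming map: letters in `Ekeep` are kept, all other
letters are renamed by `g`. -/
def ren (Ekeep : Finset A) (g : A → A) (w : List A) : List A :=
  w.map (fun a => if a ∈ Ekeep then a else g a)

theorem proj_proj_of_subset {F G : Finset A} (h : F ⊆ G) (w : List A) :
    proj F (proj G w) = proj F w := by
  unfold proj
  rw [List.filter_filter]
  refine List.filter_congr fun a _ => ?_
  have := @h a
  by_cases ha : a ∈ F <;> simp_all

theorem proj_eq_self {F : Finset A} {w : List A} (h : w ∈ star F) : proj F w = w := by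
  unfold proj
  rw [List.filter_eq_self]
  intro a ha
  simpa using h a ha

theorem proj_mem_star (F : Finset A) (w : List A) : proj F w ∈ star F := by
  intro a ha
  simpa using (List.mem_filter.1 ha).2

omit [DecidableEq A] in
theorem star_mono {F G : Finset A} (h : F ⊆ G) : star F ⊆ star G :=
  fun _ hw a ha => h (hw a ha)

omit [DecidableEq A] in
theorem mem_star_of_append {F : Finset A} {u v : List A} (h : u ++ v ∈ star F) :
    u ∈ star F := fun a ha => h a (List.mem_append_left _ ha)

theorem proj_append (F : Finset A) (u v : List A) :
    proj F (u ++ v) = proj F u ++ proj F v := List.filter_append ..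

theorem proj_congr {F G : Finset A} {w : List A} (h : ∀ a ∈ w, a ∈ F ↔ a ∈ G) :
    proj F w = proj G w :=
  List.filter_congr fun a ha => by simp [h a ha]

/-- Projections commute with prefix closure. -/
theorem pref_proj_image (F : Finset A) (L : Set (List A)) :
    pref (proj F '' L) = proj F '' pref L := by
  ext w
  constructor
  · rintro ⟨u, s, hs, hsw⟩
    obtain ⟨x, y, rfl, hx, -⟩ := List.filter_eq_append_iff.1 hsw
    exact ⟨x, ⟨y, hs⟩, hx⟩
  · rintro ⟨s, ⟨u, hu⟩, rfl⟩
    exact ⟨proj F u, s ++ u, hu, proj_append ..⟩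

/-- Two words that agree on the common letters have a common interleaving. -/
theorem exists_merge {F G : Finset A} {w : List A} (hw : w ∈ star F) {v : List A}
    (hv : v ∈ star G) (h : proj G w = proj F v) :
    ∃ s ∈ star (F ∪ G), proj F s = w ∧ proj G s = v := by
  induction w generalizing v with
  | nil =>
    exact ⟨v, star_mono Finset.subset_union_right hv, h.symm, proj_eq_self hv⟩
  | cons a w ih =>
    have haF : a ∈ F := hw a (by simp)
    have hwF : w ∈ star F := fun b hb => hw b (by simp [hb])
    by_cases haG : a ∈ G
    · have h' : v.filter (· ∈ F) = a :: proj G w := by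
        simpa [proj, haG] using h.symm
      obtain ⟨x, y, rfl, hx, -, hy⟩ := List.filter_eq_cons_iff.1 h'
      have hxG : x ∈ star G := mem_star_of_append hv
      obtain ⟨s, hs, hsF, hsG⟩ := ih hwF (v := y)
        (fun b hb => hv b (by simp [hb])) hy.symm
      have hxF : proj F x = [] := List.filter_eq_nil_iff.2 hx
      refine ⟨x ++ a :: s, ?_, ?_, ?_⟩
      · intro b hb
        rcases List.mem_append.1 hb with hb | hb
        · exact Finset.mem_union_right _ (hxG b hb)
        · rcases List.mem_cons.1 hb with rfl | hb
          · exact Finset.mem_union_left _ haF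
          · exact hs b hb
      · rw [proj_append, hxF, ← hsF]
        simp [proj, haF]
      · rw [proj_append, proj_eq_self hxG, ← hsG]
        simp [proj, haG]
    · obtain ⟨s, hs, hsF, hsG⟩ := ih hwF hv (by simpa [proj, haG] using h)
      refine ⟨a :: s, ?_, ?_, ?_⟩
      · intro b hb
        rcases List.mem_cons.1 hb with rfl | hb
        · exact Finset.mem_union_left _ haF
        · exact hs b hb
      · rw [← hsF]
        simp [proj, haF]
      · rw [← hsG]
        simp [proj, haG]

/-- A word over `F ⊇ Ek` and a family of words agreeing with it on `Ek` have a common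
interleaving, provided distinct alphabets share only letters of `Ek`. -/
theorem exists_merge_family {ι : Type} [DecidableEq ι] {E : ι → Finset A}
    {F Ek : Finset A} (hEk : Ek ⊆ F) {w : List A} (hw : w ∈ star F) {v : ι → List A}
    (T : Finset ι) (hE : ∀ i j, i ≠ j → E i ∩ E j ⊆ Ek)
    (hF : ∀ j ∈ T, E j ∩ F ⊆ Ek) (hv : ∀ j ∈ T, v j ∈ star (E j))
    (h : ∀ j ∈ T, proj (E j ∩ Ek) w = proj Ek (v j)) :
    ∃ s ∈ star (F ∪ T.sup E), proj F s = w ∧ ∀ j ∈ T, proj (E j) s = v j := by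
  induction T using Finset.induction_on with
  | empty => exact ⟨w, by simpa using hw, proj_eq_self hw, by simp⟩
  | insert j T hj ih =>
    simp only [Finset.forall_mem_insert] at hF hv h
    obtain ⟨s, hs, hsF, hsT⟩ := ih hF.2 hv.2 h.2
    have hcap : E j ∩ (F ∪ T.sup E) ⊆ Ek := by
      intro a ha
      obtain ⟨haj, ha⟩ := Finset.mem_inter.1 ha
      rcases Finset.mem_union.1 ha with ha | ha
      · exact hF.1 (Finset.mem_inter.2 ⟨haj, ha⟩)
      · obtain ⟨l, hl, hal⟩ := Finset.mem_sup.1 ha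
        exact hE j l (fun e => hj (e ▸ hl)) (Finset.mem_inter.2 ⟨haj, hal⟩)
    have hEk' : Ek ⊆ F ∪ T.sup E := hEk.trans Finset.subset_union_left
    have key : proj (E j) s = proj (F ∪ T.sup E) (v j) := by
      calc proj (E j) s = proj (E j ∩ Ek) s := proj_congr fun a ha =>
            ⟨fun haj => Finset.mem_inter.2 ⟨haj, hcap (Finset.mem_inter.2 ⟨haj, hs a ha⟩)⟩,
              fun haj => (Finset.mem_inter.1 haj).1⟩
        _ = proj (E j ∩ Ek) w := by
            rw [← hsF, proj_proj_of_subset (Finset.inter_subset_right.trans hEk)]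
        _ = proj Ek (v j) := h.1
        _ = proj (F ∪ T.sup E) (v j) := proj_congr fun a ha =>
            ⟨fun hk => hEk' hk, fun hk => hcap (Finset.mem_inter.2 ⟨hv.1 a ha, hk⟩)⟩
    obtain ⟨t, ht, htF, htj⟩ := exists_merge hs hv.1 key
    refine ⟨t, ?_, ?_, ?_⟩
    · refine star_mono ?_ ht
      rw [Finset.sup_insert, Finset.sup_eq_union, Finset.union_assoc,
        Finset.union_comm (T.sup E)]
    · rw [← hsF, ← htF, proj_proj_of_subset Finset.subset_union_left]
    · rw [Finset.forall_mem_insert]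
      refine ⟨htj, fun l hl => ?_⟩
      rw [← hsT l hl, ← htF, proj_proj_of_subset]
      exact (Finset.le_sup hl).trans Finset.subset_union_right

/-- Membership in the parallel composition of a family with a coordinator. -/
theorem mem_par_parFam {ι : Type} [Fintype ι] {E : ι → Finset A} {Ek : Finset A}
    (hkE : Ek ⊆ Finset.univ.sup E) {L : ι → Set (List A)} {Lk : Set (List A)}
    {w : List A} :
    w ∈ par (Finset.univ.sup E) Ek (parFam E L) Lk ↔
      w ∈ star (Finset.univ.sup E) ∧ (∀ i, proj (E i) w ∈ L i) ∧ proj Ek w ∈ Lk := by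
  have hsub : ∀ i, E i ⊆ Finset.univ.sup E := fun i => Finset.le_sup (Finset.mem_univ i)
  simp only [par, invProj, parFam, Set.mem_inter_iff, Set.mem_ofPred_eq,
    Finset.union_eq_left.2 hkE, proj_mem_star, proj_proj_of_subset (hsub _)]
  tauto

/-- The projection of a coordinated system onto `E i ∪ Ek` is the composition of its
`i`-th component, the coordinator, and the projections of the other components. -/
theorem proj_coordinated {ι : Type} [Fintype ι] [DecidableEq ι] {E : ι → Finset A}
    {Ek : Finset A} (hs : ∀ i j, i ≠ j → E i ∩ E j ⊆ Ek) (hkE : Ek ⊆ Finset.univ.sup E)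
    {L : ι → Set (List A)} {Lk : Set (List A)} (hL : ∀ i, L i ⊆ star (E i)) (i : ι) :
    proj (E i ∪ Ek) '' par (Finset.univ.sup E) Ek (parFam E L) Lk =
      {w | w ∈ star (E i ∪ Ek) ∧ proj (E i) w ∈ L i ∧ proj Ek w ∈ Lk ∧
        ∀ j, j ≠ i → proj (E j ∩ Ek) w ∈ proj Ek '' L j} := by
  ext w
  constructor
  · rintro ⟨s, hsm, rfl⟩
    obtain ⟨-, hsL, hsk⟩ := (mem_par_parFam hkE).1 hsm
    refine ⟨proj_mem_star _ _, ?_, ?_, fun j _ => ⟨proj (E j) s, hsL j, ?_⟩⟩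
    · rw [proj_proj_of_subset Finset.subset_union_left]
      exact hsL i
    · rw [proj_proj_of_subset Finset.subset_union_right]
      exact hsk
    · rw [proj_proj_of_subset (Finset.inter_subset_right.trans Finset.subset_union_right)]
      unfold proj
      rw [List.filter_filter]
      exact List.filter_congr fun a _ => by simp [and_comm]
  · rintro ⟨hw, hwi, hwk, hwj⟩
    choose! v hvL hv using hwj
    obtain ⟨s, hsm, hsw, hsv⟩ := exists_merge_family (E := E) Finset.subset_union_right hw
      (v := v) (Finset.univ.erase i) hs
      (fun j hj a ha => by
        obtain ⟨haj, ha⟩ := Finset.mem_inter.1 ha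
        rcases Finset.mem_union.1 ha with ha | ha
        · exact hs j i (Finset.ne_of_mem_erase hj) (Finset.mem_inter.2 ⟨haj, ha⟩)
        · exact ha)
      (fun j hj => hL j (hvL j (Finset.ne_of_mem_erase hj)))
      (fun j hj => (hv j (Finset.ne_of_mem_erase hj)).symm)
    refine ⟨s, (mem_par_parFam hkE).2 ⟨star_mono ?_ hsm, fun j => ?_, ?_⟩, hsw⟩
    · exact Finset.union_subset
        (Finset.union_subset (Finset.le_sup (Finset.mem_univ i)) hkE)
        (Finset.sup_mono (Finset.erase_subset _ _))
    · by_cases hj : j = i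
      · subst hj
        rwa [← hsw, proj_proj_of_subset Finset.subset_union_left] at hwi
      · rw [hsv j (by simp [hj])]
        exact hvL j hj
    · rwa [← hsw, proj_proj_of_subset Finset.subset_union_right] at hwk

/-- A coordinated system is conditionally decomposable. -/
theorem condDecomp_coordinated {ι : Type} [Fintype ι] [Nonempty ι] {E : ι → Finset A}
    {Ek : Finset A} (hkE : Ek ⊆ Finset.univ.sup E) (L : ι → Set (List A))
    (Lk : Set (List A)) :
    condDecomp E Ek (par (Finset.univ.sup E) Ek (parFam E L) Lk) := by
  have hsup : (Finset.univ.sup fun i => E i ∪ Ek) = Finset.univ.sup E :=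
    le_antisymm
      (Finset.sup_le fun i hi => Finset.union_subset (Finset.le_sup hi) hkE)
      (Finset.sup_mono_fun fun _ _ => Finset.subset_union_left)
  ext w
  constructor
  · intro hw
    refine ⟨?_, fun i => ⟨w, hw, rfl⟩⟩
    rw [hsup]
    exact ((mem_par_parFam hkE).1 hw).1
  · rintro ⟨hw, h⟩
    rw [hsup] at hw
    have key (i : ι) : proj (E i) w ∈ L i ∧ proj Ek w ∈ Lk := by
      obtain ⟨s, hsm, hsw⟩ := h i
      obtain ⟨-, hsL, hsk⟩ := (mem_par_parFam hkE).1 hsm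
      have hEi := congrArg (proj (E i)) hsw
      have hEk := congrArg (proj Ek) hsw
      rw [proj_proj_of_subset Finset.subset_union_left,
        proj_proj_of_subset Finset.subset_union_left] at hEi
      rw [proj_proj_of_subset Finset.subset_union_right,
        proj_proj_of_subset Finset.subset_union_right] at hEk
      rw [← hEi, ← hEk]
      exact ⟨hsL i, hsk⟩
    exact (mem_par_parFam hkE).2 ⟨hw, fun i => (key i).1, (key (Classical.arbitrary ι)).2⟩

/-- the coordinated system `G = G₁ ∥ ⋯ ∥ Gₙ ∥ G_k` is
nonblocking iff (1) each `Gᵢ ∥ G_k ∥ (∥_{j≠i} P_k(G_j))` is nonblocking and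
(2) `overline(L_m(G))` is conditionally decomposable w.r.t.
`E₁, …, Eₙ, E_k`.  Generators are modeled by pairs `(K i, N i)` of marked and
generated languages; `P_k(G_j)` is the generator with marked language
`P_k(K j) ⊆ (E_j ∩ E_k)*` and generated language `P_k(N j)`. -/
theorem stmt11 {A : Type} [DecidableEq A] {n : ℕ} (hn : 2 ≤ n)
    (E : Fin n → Finset A) (Ek : Finset A)
    (hs : ∀ i j, i ≠ j → E i ∩ E j ⊆ Ek)
    (hkE : Ek ⊆ Finset.univ.sup E)
    (K N : Fin n → Set (List A)) (Kk Nk : Set (List A))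
    (hKE : ∀ i, K i ⊆ star (E i)) (hNE : ∀ i, N i ⊆ star (E i))
    (hNpc : ∀ i, pref (N i) = N i) (hKN : ∀ i, pref (K i) ⊆ N i)
    (hKkE : Kk ⊆ star Ek) (hNkE : Nk ⊆ star Ek)
    (hNkpc : pref Nk = Nk) (hKNk : pref Kk ⊆ Nk)
    (GK GN : Set (List A))
    (hGK : GK = par (Finset.univ.sup E) Ek (parFam E K) Kk)
    (hGN : GN = par (Finset.univ.sup E) Ek (parFam E N) Nk) :
    pref GK = GN ↔
      ((∀ i : Fin n,
          pref {w | w ∈ star (E i ∪ Ek) ∧ proj (E i) w ∈ K i ∧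
                proj Ek w ∈ Kk ∧
                ∀ j, j ≠ i → proj (E j ∩ Ek) w ∈ proj Ek '' K j} =
            {w | w ∈ star (E i ∪ Ek) ∧ proj (E i) w ∈ N i ∧
                proj Ek w ∈ Nk ∧
                ∀ j, j ≠ i → proj (E j ∩ Ek) w ∈ proj Ek '' N j}) ∧
        condDecomp E Ek (pref GK)) := by
  have : Nonempty (Fin n) := ⟨⟨0, by omega⟩⟩
  have hN : condDecomp E Ek GN := hGN ▸ condDecomp_coordinated hkE N Nk
  simp only [← proj_coordinated hs hkE hKE, ← proj_coordinated hs hkE hNE, ← hGK, ← hGN,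
    pref_proj_image]
  constructor
  · intro h
    rw [h]
    exact ⟨fun _ => rfl, hN⟩
  · rintro ⟨h, hK⟩
    rw [condDecomp] at hK hN
    simp only [h] at hK
    exact hK.trans hN.symm

end DES
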